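/- arXiv:2310.11736 — 9 statements merged into one kernel-verified Lean document; each statement's English description precedes it below -/
import Mathlib

section
/- Let p be a positive integer, φ : [0,∞) → ℝ, and U a p×p real matrix with Σ = UUᵀ. Let H_Σ be a Hilbert space of functions ℝ^p → ℝ with reproducing kernel (x,x') ↦ φ((x−x')ᵀΣ(x−x')), and let H_I be a Hilbert space of functions ℝ^p → ℝ with reproducing kernel (x,x') ↦ φ(‖x−x'‖₂²). Then H_Σ = {f : ℝ^p → ℝ | ∃ g ∈ H_I such that f(x) = g(Uᵀx) for all x ∈ ℝ^p}. Moreover, if U is invertible, then for every f ∈ H_Σ there is a unique g ∈ H_I with f(x) = g(Uᵀx) for all x, and this correspondence ι_U : H_Σ → H_I preserves inner products: ⟨f₁, f₂⟩_{H_Σ} = ⟨ι_U f₁, ι_U f₂⟩_{H_I} for all f₁, f₂ ∈ H_Σ. -/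
open scoped InnerProductSpace Matrix

/-- Two families with the same Gram matrix, the first one total: there is a linear map
preserving inner products that carries the first one to the second one. -/
theorem exists_isometry_of_gram {X E F : Type*}
    [NormedAddCommGroup E] [InnerProductSpace ℝ E] [CompleteSpace E]
    [NormedAddCommGroup F] [InnerProductSpace ℝ F] [CompleteSpace F]
    (a : X → E) (b : X → F) (htot : ∀ f : E, (∀ x, ⟪f, a x⟫_ℝ = 0) → f = 0)
    (hG : ∀ x y, ⟪a x, a y⟫_ℝ = ⟪b x, b y⟫_ℝ) :
    ∃ T : E →L[ℝ] F, (∀ x, T (a x) = b x) ∧ ∀ f g, ⟪f, g⟫_ℝ = ⟪T f, T g⟫_ℝ := by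
  classical
  set A := Finsupp.linearCombination ℝ a with hA
  set B := Finsupp.linearCombination ℝ b with hB
  have hin : ∀ c d, ⟪A c, A d⟫_ℝ = ⟪B c, B d⟫_ℝ := by
    intro c d
    simp only [hA, hB, Finsupp.linearCombination_apply, Finsupp.sum_inner, Finsupp.inner_sum,
      real_inner_smul_left, real_inner_smul_right, hG]
  have hnorm : ∀ c, ‖B c‖ ≤ 1 * ‖A c‖ := by
    intro c
    rw [one_mul, @norm_eq_sqrt_real_inner F, @norm_eq_sqrt_real_inner E, hin]
  have hdense : DenseRange A := by
    have h1 : (LinearMap.range A).topologicalClosure = ⊤ := by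
      rw [Submodule.topologicalClosure_eq_top_iff, Submodule.eq_bot_iff]
      intro f hf
      apply htot
      intro x
      rw [Submodule.mem_orthogonal'] at hf
      exact hf _ ⟨Finsupp.single x 1, by simp [hA]⟩
    have h2 := Submodule.dense_iff_topologicalClosure_eq_top.2 h1
    rwa [LinearMap.coe_range] at h2
  have hT : ∀ c, B.extendOfNorm A (A c) = B c :=
    LinearMap.extendOfNorm_eq hdense ⟨1, hnorm⟩
  refine ⟨B.extendOfNorm A, ?_, ?_⟩
  · intro x
    have := hT (Finsupp.single x 1)
    simpa [hA, hB] using this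
  · intro f g
    refine hdense.induction_on₂ (p := fun f g => ⟪f, g⟫_ℝ =
      ⟪B.extendOfNorm A f, B.extendOfNorm A g⟫_ℝ) ?_ ?_ f g
    · exact isClosed_eq (by fun_prop) (by fun_prop)
    · intro c d
      rw [hT, hT, hin]

/-- With `Σ = U Uᵀ`, the RKHS `H_Σ` of kernel `φ((x−x')ᵀΣ(x−x'))` consists
exactly of the functions `x ↦ g(Uᵀ x)` with `g ∈ H_I` (the RKHS of kernel `φ(‖x−x'‖₂²)`);
moreover if `U` is invertible the induced map `ι_U : H_Σ → H_I` is well defined, unique, and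
preserves inner products. -/
theorem rkhs_scaling_correspondence
    (p : ℕ) (hp : 0 < p)
    (φ : ℝ → ℝ)
    (U : Matrix (Fin p) (Fin p) ℝ)
    (HS : Type*) [NormedAddCommGroup HS] [InnerProductSpace ℝ HS] [CompleteSpace HS]
    (HI : Type*) [NormedAddCommGroup HI] [InnerProductSpace ℝ HI] [CompleteSpace HI]
    (evS : HS → (Fin p → ℝ) → ℝ) (KS : (Fin p → ℝ) → HS)
    (hinjS : Function.Injective evS)
    (hKS : ∀ x x' : Fin p → ℝ,
      evS (KS x) x' = φ ((x - x') ⬝ᵥ ((U * Uᵀ) *ᵥ (x - x'))))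
    (hrepS : ∀ (f : HS) (x : Fin p → ℝ), evS f x = ⟪f, KS x⟫_ℝ)
    (evI : HI → (Fin p → ℝ) → ℝ) (KI : (Fin p → ℝ) → HI)
    (hinjI : Function.Injective evI)
    (hKI : ∀ x x' : Fin p → ℝ, evI (KI x) x' = φ (∑ i, (x i - x' i) ^ 2))
    (hrepI : ∀ (g : HI) (x : Fin p → ℝ), evI g x = ⟪g, KI x⟫_ℝ) :
    -- H_Σ = {f | ∃ g ∈ H_I, f(x) = g(Uᵀ x)}
    ((∀ F : (Fin p → ℝ) → ℝ,
        (∃ f : HS, evS f = F) ↔ (∃ g : HI, ∀ x, F x = evI g (Uᵀ *ᵥ x))) ∧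
    -- if U is invertible, the correspondence ι_U exists, is unique, and is an isometry
      (IsUnit U →
        ∃ ι : HS → HI,
          (∀ f : HS, (∀ x, evS f x = evI (ι f) (Uᵀ *ᵥ x)) ∧
            (∀ g : HI, (∀ x, evS f x = evI g (Uᵀ *ᵥ x)) → g = ι f)) ∧
          (∀ f₁ f₂ : HS, ⟪f₁, f₂⟫_ℝ = ⟪ι f₁, ι f₂⟫_ℝ))) := by
  have hG : ∀ x y, ⟪KS x, KS y⟫_ℝ = ⟪KI (Uᵀ *ᵥ x), KI (Uᵀ *ᵥ y)⟫_ℝ := by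
    intro x y
    rw [← hrepS, ← hrepI, hKS, hKI, ← Matrix.mulVec_mulVec, Matrix.dotProduct_mulVec,
      ← Matrix.mulVec_transpose, Matrix.mulVec_sub]
    simp [dotProduct, pow_two]
  have htot : ∀ f : HS, (∀ x, ⟪f, KS x⟫_ℝ = 0) → f = 0 := by
    intro f hf
    apply hinjS
    funext x
    rw [hrepS, hrepS, hf, inner_zero_left]
  obtain ⟨T, hTK, hT⟩ := exists_isometry_of_gram KS (fun x => KI (Uᵀ *ᵥ x)) htot hG
  have hev : ∀ f x, evS f x = evI (T f) (Uᵀ *ᵥ x) := by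
    intro f x
    rw [hrepS, hrepI, hT, hTK]
  refine ⟨fun F => ⟨?_, ?_⟩, fun hU => ⟨T, fun f => ⟨hev f, fun g hg => ?_⟩, hT⟩⟩
  · rintro ⟨f, rfl⟩
    exact ⟨T f, hev f⟩
  · rintro ⟨g, hg⟩
    refine ⟨T.adjoint g, ?_⟩
    funext x
    rw [hrepS, hg, hrepI, ContinuousLinearMap.adjoint_inner_left, hTK]
  · apply hinjI
    funext y
    have hdet : IsUnit (Uᵀ).det := by
      rw [Matrix.det_transpose]
      exact (Matrix.isUnit_iff_isUnit_det U).1 hU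
    have hy : Uᵀ *ᵥ ((Uᵀ)⁻¹ *ᵥ y) = y := by
      rw [Matrix.mulVec_mulVec, Matrix.mul_nonsing_inv _ hdet, Matrix.one_mulVec]
    rw [← hy, ← hg, ← hev]
end

section
/- Let p be a positive integer and let μ be a nonzero finite (nonnegative) measure on (0,∞). Define φ̃ : [0,∞) → ℝ by φ̃(z) = ∫₀^∞ e^{−tz} dμ(t). Then the kernel (x,x') ↦ φ̃(‖x−x'‖₂²) on ℝ^p is integrally strictly positive definite: for any two finite (nonnegative) Borel measures ν₁ ≠ ν₂ on ℝ^p, ∫∫ φ̃(‖x−y‖₂²) dν₁(x)dν₁(y) + ∫∫ φ̃(‖x−y‖₂²) dν₂(x)dν₂(y) − 2∫∫ φ̃(‖x−y‖₂²) dν₁(x)dν₂(y) > 0. Equivalently, ∫∫ φ̃(‖x−y‖₂²) dν(x)dν(y) > 0 for every nonzero finite signed Borel measure ν on ℝ^p. -/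
open MeasureTheory ProbabilityTheory
noncomputable def FF {p : ℕ} (ν : Measure (Fin p → ℝ)) (w : Fin p → ℝ) : ℂ :=
  ∫ x, Complex.exp (Complex.I * ((∑ i, x i * w i : ℝ) : ℂ)) ∂ν

noncomputable def gam (p : ℕ) (t : ℝ) : Measure (Fin p → ℝ) :=
  Measure.pi fun _ => gaussianReal 0 (2 * t).toNNReal

instance (p : ℕ) (t : ℝ) : IsProbabilityMeasure (gam p t) := by unfold gam; infer_instance

lemma gam_open (p : ℕ) {t : ℝ} (ht : 0 < t) : (gam p t).IsOpenPosMeasure := by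
  have h : (gaussianReal 0 (2 * t).toNNReal).IsOpenPosMeasure := by
    refine (gaussianReal_absolutelyContinuous' 0 (v := (2 * t).toNNReal) ?_).isOpenPosMeasure
    simpa using ht
  unfold gam; infer_instance

lemma norm_e (r : ℝ) : ‖Complex.exp (Complex.I * (r : ℂ))‖ = 1 := by
  rw [mul_comm]; exact Complex.norm_exp_ofReal_mul_I r

lemma FF_cont {p : ℕ} (ν : Measure (Fin p → ℝ)) [IsFiniteMeasure ν] : Continuous (FF ν) := by
  unfold FF
  refine continuous_of_dominated (bound := fun _ => 1) ?_ ?_ (integrable_const _) ?_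
  · intro w
    exact (by fun_prop : Continuous _).aestronglyMeasurable
  · intro w
    exact ae_of_all _ fun x => (norm_e _).le
  · exact ae_of_all _ fun x => by fun_prop

lemma FF_norm {p : ℕ} (ν : Measure (Fin p → ℝ)) [IsFiniteMeasure ν] (w) : ‖FF ν w‖ ≤ ν.real Set.univ := by
  have := norm_integral_le_of_norm_le_const (μ := ν) (C := 1)
    (f := fun x : Fin p → ℝ => Complex.exp (Complex.I * ((∑ i, x i * w i : ℝ) : ℂ)))
    (ae_of_all _ fun x => (norm_e _).le)
  simpa [FF] using this

lemma FF_ext {p : ℕ} (ν₁ ν₂ : Measure (Fin p → ℝ)) [IsFiniteMeasure ν₁] [IsFiniteMeasure ν₂]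
    (h : ∀ w, FF ν₁ w = FF ν₂ w) : ν₁ = ν₂ := by
  refine Measure.ext_of_charFunDual ?_
  ext L
  rw [charFunDual_apply, charFunDual_apply]
  have hL : ∀ x, L x = ∑ i, x i * L (Pi.single i 1) := by
    intro x
    conv_lhs => rw [pi_eq_sum_univ' x]
    simp [map_sum]
  have := h fun i => L (Pi.single i 1)
  simp only [FF, ← hL] at this
  simpa [mul_comm] using this

lemma gauss {p : ℕ} {t : ℝ} (ht : 0 ≤ t) (u : Fin p → ℝ) :
    ∫ w, Complex.exp (Complex.I * ((∑ i, u i * w i : ℝ) : ℂ)) ∂(gam p t)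
      = ((Real.exp (-t * ∑ i, u i ^ 2) : ℝ) : ℂ) := by
  have h1 : ∀ w : Fin p → ℝ, Complex.exp (Complex.I * ((∑ i, u i * w i : ℝ) : ℂ))
      = ∏ i, Complex.exp (u i * w i * Complex.I) := by
    intro w
    rw [← Complex.exp_sum]; congr 1; push_cast; rw [Finset.mul_sum]
    exact Finset.sum_congr rfl fun i _ => by ring
  simp_rw [h1]
  unfold gam
  rw [integral_fintype_prod_eq_prod (𝕜 := ℂ) (fun i (w : ℝ) => Complex.exp (u i * w * Complex.I))]
  simp_rw [← charFun_apply_real, charFun_gaussianReal]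
  rw [← Complex.exp_sum, Complex.ofReal_exp]; congr 1; push_cast; rw [Finset.mul_sum]
  refine Finset.sum_congr rfl fun i _ => ?_
  have : (((2 * t).toNNReal : ℝ) : ℂ) = 2 * t := by
    rw [Real.coe_toNNReal _ (by positivity)]; push_cast; rfl
  rw [this]; push_cast; ring

lemma keyB {p : ℕ} {t : ℝ} (ht : 0 ≤ t) (ν ν' : Measure (Fin p → ℝ)) [IsFiniteMeasure ν]
    [IsFiniteMeasure ν'] :
    ∫ z, Real.exp (-t * ∑ i, (z.1 i - z.2 i) ^ 2) ∂(ν.prod ν')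
      = ∫ w, (FF ν w * (starRingEnd ℂ) (FF ν' w)).re ∂(gam p t) := by
  have hint : Integrable (fun w => FF ν w * (starRingEnd ℂ) (FF ν' w)) (gam p t) := by
    refine Integrable.of_bound (C := ν.real Set.univ * ν'.real Set.univ) ?_ (ae_of_all _ fun w => ?_)
    · have := FF_cont ν
      have := FF_cont ν'
      exact (by fun_prop : Continuous _).aestronglyMeasurable
    · rw [norm_mul, RCLike.norm_conj]
      exact mul_le_mul (FF_norm _ _) (FF_norm _ _) (norm_nonneg _) (by positivity)
  have hre := integral_re hint
  simp only [RCLike.re_eq_complex_re] at hre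
  rw [hre]
  rw [← Complex.ofReal_re (∫ z, Real.exp (-t * ∑ i, (z.1 i - z.2 i) ^ 2) ∂(ν.prod ν'))]
  congr 1
  rw [← integral_complex_ofReal]
  have h1 : ∀ z : (Fin p → ℝ) × (Fin p → ℝ), ((Real.exp (-t * ∑ i, (z.1 i - z.2 i) ^ 2) : ℝ) : ℂ)
      = ∫ w, Complex.exp (Complex.I * ((∑ i, (z.1 i - z.2 i) * w i : ℝ) : ℂ)) ∂(gam p t) :=
    fun z => (gauss ht (fun i => z.1 i - z.2 i)).symm
  simp_rw [h1]
  rw [integral_integral_swap]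
  · congr 1; ext w
    unfold FF
    rw [← integral_conj, ← integral_prod_mul]
    congr 1; ext z
    rw [← Complex.exp_conj, ← Complex.exp_add]
    congr 1
    simp [sub_mul, Finset.sum_sub_distrib]
    ring
  · refine Integrable.of_bound (C := 1) ?_ (ae_of_all _ fun w => (norm_e _).le)
    unfold Function.uncurry
    exact (by fun_prop : Continuous _).aestronglyMeasurable

lemma Dpos {p : ℕ} {t : ℝ} (ht : 0 < t) (ν₁ ν₂ : Measure (Fin p → ℝ)) [IsFiniteMeasure ν₁]
    [IsFiniteMeasure ν₂] (hne : ν₁ ≠ ν₂) :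
    0 < (∫ z, Real.exp (-t * ∑ i, (z.1 i - z.2 i) ^ 2) ∂(ν₁.prod ν₁))
      + (∫ z, Real.exp (-t * ∑ i, (z.1 i - z.2 i) ^ 2) ∂(ν₂.prod ν₂))
      - 2 * ∫ z, Real.exp (-t * ∑ i, (z.1 i - z.2 i) ^ 2) ∂(ν₁.prod ν₂) := by
  have hint : ∀ (ν ν' : Measure (Fin p → ℝ)) [IsFiniteMeasure ν] [IsFiniteMeasure ν'],
      Integrable (fun w => (FF ν w * (starRingEnd ℂ) (FF ν' w)).re) (gam p t) := by
    intro ν ν' _ _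
    refine Integrable.of_bound (C := ν.real Set.univ * ν'.real Set.univ) ?_ (ae_of_all _ fun w => ?_)
    · have := FF_cont ν
      have := FF_cont ν'
      exact (by fun_prop : Continuous _).aestronglyMeasurable
    · refine (Complex.abs_re_le_norm _).trans ?_
      rw [norm_mul, RCLike.norm_conj]
      exact mul_le_mul (FF_norm _ _) (FF_norm _ _) (norm_nonneg _) (by positivity)
  have h11 := hint ν₁ ν₁
  have h22 := hint ν₂ ν₂
  have h12 := (hint ν₁ ν₂).const_mul 2
  rw [keyB ht.le, keyB ht.le, keyB ht.le, ← integral_const_mul, ← integral_add h11 h22,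
    ← integral_sub (by exact h11.add h22) h12]
  have heq : ∀ w, (FF ν₁ w * (starRingEnd ℂ) (FF ν₁ w)).re + (FF ν₂ w * (starRingEnd ℂ) (FF ν₂ w)).re
      - 2 * (FF ν₁ w * (starRingEnd ℂ) (FF ν₂ w)).re = Complex.normSq (FF ν₁ w - FF ν₂ w) := by
    intro w
    simp [Complex.normSq_apply]; ring
  have hI := (h11.add h22).sub h12
  have hI' : Integrable (fun w => Complex.normSq (FF ν₁ w - FF ν₂ w)) (gam p t) :=
    hI.congr (ae_of_all _ heq)
  simp_rw [heq]
  obtain ⟨w, hw⟩ : ∃ w, FF ν₁ w ≠ FF ν₂ w := by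
    by_contra! h
    exact hne (FF_ext _ _ h)
  have := gam_open p ht
  have c1 := FF_cont ν₁
  have c2 := FF_cont ν₂
  refine integral_pos_of_integrable_nonneg_nonzero (x := w) ?_ hI' (fun w => Complex.normSq_nonneg _) ?_
  · exact Complex.continuous_normSq.comp (c1.sub c2)
  · simpa [sub_eq_zero] using hw

lemma mix {p : ℕ} (μ : Measure ℝ) [IsFiniteMeasure μ] (hμsupp : μ (Set.Iic 0) = 0)
    (φ : ℝ → ℝ) (hφ : ∀ z : ℝ, φ z = ∫ t, Real.exp (-t * z) ∂μ)
    (ν ν' : Measure (Fin p → ℝ)) [IsFiniteMeasure ν] [IsFiniteMeasure ν'] :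
    Integrable (fun t => ∫ z, Real.exp (-t * ∑ i, (z.1 i - z.2 i) ^ 2) ∂(ν.prod ν')) μ ∧
    ∫ x, ∫ y, φ (∑ i, (x i - y i) ^ 2) ∂ν' ∂ν
      = ∫ t, ∫ z, Real.exp (-t * ∑ i, (z.1 i - z.2 i) ^ 2) ∂(ν.prod ν') ∂μ := by
  have hpos : ∀ᵐ t ∂μ, 0 < t := by
    rw [ae_iff]; simpa [Set.Iic] using hμsupp
  have hI : Integrable (fun q : ℝ × ((Fin p → ℝ) × (Fin p → ℝ)) =>
      Real.exp (-q.1 * ∑ i, (q.2.1 i - q.2.2 i) ^ 2)) (μ.prod (ν.prod ν')) := by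
    refine Integrable.of_bound (C := 1) ?_ ?_
    · exact (by fun_prop : Continuous _).aestronglyMeasurable
    · filter_upwards [Measure.quasiMeasurePreserving_fst.ae hpos] with q hq
      rw [Real.norm_eq_abs, Real.abs_exp, Real.exp_le_one_iff]
      have : 0 ≤ ∑ i, (q.2.1 i - q.2.2 i) ^ 2 := Finset.sum_nonneg fun i _ => sq_nonneg _
      nlinarith
  refine ⟨hI.integral_prod_left, ?_⟩
  rw [integral_integral_swap (f := fun (t : ℝ) (z : (Fin p → ℝ) × (Fin p → ℝ)) =>
    Real.exp (-t * ∑ i, (z.1 i - z.2 i) ^ 2)) hI]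
  rw [integral_prod _ hI.integral_prod_right]
  simp_rw [hφ]

theorem radial_kernel_integrally_strictly_positive_definite
    (p : ℕ) (hp : 0 < p)
    (μ : Measure ℝ) [IsFiniteMeasure μ] (hμ0 : μ ≠ 0) (hμsupp : μ (Set.Iic 0) = 0)
    (φ : ℝ → ℝ) (hφ : ∀ z : ℝ, φ z = ∫ t, Real.exp (-t * z) ∂μ)
    (ν₁ ν₂ : Measure (Fin p → ℝ)) [IsFiniteMeasure ν₁] [IsFiniteMeasure ν₂]
    (hne : ν₁ ≠ ν₂) :
    0 < (∫ x, ∫ y, φ (∑ i, (x i - y i) ^ 2) ∂ν₁ ∂ν₁)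
        + (∫ x, ∫ y, φ (∑ i, (x i - y i) ^ 2) ∂ν₂ ∂ν₂)
        - 2 * ∫ x, ∫ y, φ (∑ i, (x i - y i) ^ 2) ∂ν₂ ∂ν₁ := by
  have hpos : ∀ᵐ t ∂μ, 0 < t := by
    rw [ae_iff]; simpa [Set.Iic] using hμsupp
  obtain ⟨h11, e11⟩ := mix μ hμsupp φ hφ ν₁ ν₁
  obtain ⟨h22, e22⟩ := mix μ hμsupp φ hφ ν₂ ν₂
  obtain ⟨h12, e12⟩ := mix μ hμsupp φ hφ ν₁ ν₂
  have h12 := h12.const_mul 2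
  rw [e11, e22, e12, ← integral_const_mul, ← integral_add h11 h22,
    ← integral_sub (by exact h11.add h22) h12]
  have hD := hpos.mono fun t ht => Dpos ht ν₁ ν₂ hne
  rw [integral_pos_iff_support_of_nonneg_ae (hD.mono fun t ht => ht.le) ((h11.add h22).sub h12)]
  rw [pos_iff_ne_zero]
  intro h0
  apply hμ0
  rw [← ae_eq_bot, ← Filter.eventually_false_iff_eq_bot]
  filter_upwards [hD, measure_eq_zero_iff_ae_notMem.1 h0] with t h1 h2
  exact h2 h1.ne'
end

section
/- Let p be a positive integer, let C denote the set of p×p real symmetric positive semidefinite matrices (viewed as a subset of the space of p×p real matrices with the Frobenius inner product ⟨A,B⟩ = tr(AᵀB)), and let S be a linear subspace of ℝ^p with orthogonal complement S⊥. Let Σ ∈ C with column space col(Σ) ⊆ S. Then for every p×p real matrix W, the following are equivalent: (i) W belongs to the tangent cone of C at Σ and col(W) ⊆ S⊥; (ii) W is symmetric positive semidefinite and W = Π_{S⊥} W Π_{S⊥}, where Π_{S⊥} is the orthogonal projection matrix onto S⊥ (equivalently, W is positive semidefinite with col(W) ⊆ S⊥). -/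
open scoped Matrix
open Filter

theorem mul_of_range_le {p : ℕ} (Q A : Matrix (Fin p) (Fin p) ℝ) (hQ : Q * Q = Q)
    (h : LinearMap.range A.mulVecLin ≤ LinearMap.range Q.mulVecLin) : Q * A = A := by
  apply Matrix.toLin'.injective
  ext1 x
  ext1
  simp only [LinearMap.comp_apply, Matrix.toLin'_apply, ← Matrix.mulVec_mulVec]
  obtain ⟨y, hy⟩ := h (LinearMap.mem_range_self A.mulVecLin (LinearMap.single ℝ (fun _ => ℝ) x 1))
  simp only [Matrix.mulVecLin_apply] at hy
  rw [← hy, Matrix.mulVec_mulVec, hQ]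

/-- Let `C` be the PSD cone, `S` a subspace of `ℝ^p` encoded by its
orthogonal projection matrix `Pr` (symmetric idempotent), so `Π_{S⊥} = 1 - Pr`, and let
`Σ ∈ C` with `col(Σ) ⊆ S`.  For a matrix `W`, membership in the tangent cone of `C` at `Σ`
(limits `lim tₙ(Σₙ − Σ)` with `Σₙ ∈ C`, `tₙ → ∞`) together with `col(W) ⊆ S⊥` is equivalent
to: `W` is positive semidefinite and `W = Π_{S⊥} W Π_{S⊥}`. -/
theorem tangent_cone_perp_characterization
    (p : ℕ) (hp : 0 < p)
    (Pr : Matrix (Fin p) (Fin p) ℝ) (hPrsymm : Pr.IsSymm) (hPridem : Pr * Pr = Pr)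
    (Sg : Matrix (Fin p) (Fin p) ℝ) (hSg : Sg.PosSemidef)
    (hcol : LinearMap.range Sg.mulVecLin ≤ LinearMap.range Pr.mulVecLin)
    (W : Matrix (Fin p) (Fin p) ℝ) :
    ((∃ (t : ℕ → ℝ) (S : ℕ → Matrix (Fin p) (Fin p) ℝ),
        (∀ n, (S n).PosSemidef) ∧
        Tendsto t atTop atTop ∧
        Tendsto (fun n => t n • (S n - Sg)) atTop (nhds W)) ∧
      LinearMap.range W.mulVecLin ≤ LinearMap.range (1 - Pr).mulVecLin)
    ↔ (W.PosSemidef ∧ W = (1 - Pr) * W * (1 - Pr)) := by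
  have hQs : (1 - Pr)ᵀ = 1 - Pr := by
    rw [Matrix.transpose_sub, Matrix.transpose_one, hPrsymm.eq]
  have hQi : (1 - Pr) * (1 - Pr) = 1 - Pr := by
    simp [sub_mul, mul_sub, hPridem]
  have hSgs : Sgᵀ = Sg := by simpa [Matrix.IsHermitian] using hSg.1
  have hPS : Pr * Sg = Sg := mul_of_range_le Pr Sg hPridem hcol
  have hQS : (1 - Pr) * Sg = 0 := by rw [sub_mul, hPS, one_mul, sub_self]
  constructor
  · rintro ⟨⟨t, S, hS, ht, hlim⟩, hW⟩
    have hQW : (1 - Pr) * W = W := mul_of_range_le _ W hQi hW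
    have hWs : Wᵀ = W := by
      have h1 : Tendsto (fun n => (t n • (S n - Sg))ᵀ) atTop (nhds Wᵀ) :=
        (continuous_id.matrix_transpose.tendsto W).comp hlim
      have h2 : (fun n => (t n • (S n - Sg))ᵀ) = fun n => t n • (S n - Sg) := by
        funext n
        have : (S n)ᵀ = S n := by simpa [Matrix.IsHermitian] using (hS n).1
        rw [Matrix.transpose_smul, Matrix.transpose_sub, this, hSgs]
      rw [h2] at h1
      exact tendsto_nhds_unique h1 hlim
    have hWQ : W * (1 - Pr) = W := by
      have := congrArg Matrix.transpose hQW
      rwa [Matrix.transpose_mul, hQs, hWs] at this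
    have hWeq : W = (1 - Pr) * W * (1 - Pr) := by rw [hQW, hWQ]
    refine ⟨?_, hWeq⟩
    refine Matrix.PosSemidef.of_dotProduct_mulVec_nonneg (by simpa [Matrix.IsHermitian] using hWs) ?_
    intro x
    have hc : Continuous fun M : Matrix (Fin p) (Fin p) ℝ =>
        star x ⬝ᵥ (((1 - Pr) * M * (1 - Pr)) *ᵥ x) := by fun_prop
    have h3 := (hc.tendsto W).comp hlim
    rw [← hWeq] at h3
    refine ge_of_tendsto h3 ?_
    filter_upwards [ht.eventually_ge_atTop 0] with n hn
    have h4 : (1 - Pr) * (t n • (S n - Sg)) * (1 - Pr)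
        = t n • ((1 - Pr) * S n * (1 - Pr)) := by
      rw [Matrix.mul_smul, mul_sub (1 - Pr) (S n) Sg, hQS, sub_zero, Matrix.smul_mul]
    have h5 := ((hS n).mul_mul_conjTranspose_same (1 - Pr)).dotProduct_mulVec_nonneg x
    rw [Matrix.conjTranspose_eq_transpose_of_trivial, hQs] at h5
    simp only [Function.comp]
    rw [h4, Matrix.smul_mulVec, dotProduct_smul]
    exact mul_nonneg hn h5
  · rintro ⟨hW, hWeq⟩
    refine ⟨⟨fun n => (n : ℝ) + 1, fun n => Sg + ((n : ℝ) + 1)⁻¹ • W, ?_, ?_, ?_⟩, ?_⟩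
    · intro n
      exact hSg.add (hW.smul (by positivity))
    · exact tendsto_atTop_add_const_right _ _ tendsto_natCast_atTop_atTop
    · have : (fun n : ℕ => ((n : ℝ) + 1) • (Sg + ((n : ℝ) + 1)⁻¹ • W - Sg)) = fun _ => W := by
        funext n
        have : (n : ℝ) + 1 ≠ 0 := by positivity
        rw [add_sub_cancel_left, smul_inv_smul₀ this]
      rw [this]
      exact tendsto_const_nhds
    · rintro _ ⟨x, rfl⟩
      refine ⟨(W * (1 - Pr)) *ᵥ x, ?_⟩
      rw [Matrix.mulVecLin_apply, Matrix.mulVecLin_apply, Matrix.mulVec_mulVec, ← mul_assoc,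
        ← hWeq]
end

section
/- Let p be a positive integer, let N be a norm on p×p real matrices that is monotone with respect to the positive semidefinite order (if 0 ⪯ A ⪯ B then N(A) ≤ N(B)), and let M > 0. Let C_M = {Σ : Σ is p×p symmetric positive semidefinite and N(Σ) ≤ M}. Let Σ ∈ C_M and let Z be a p×p real matrix satisfying ⟨Σ' − Σ, Z⟩ ≤ 0 for every Σ' ∈ C_M, where ⟨A,B⟩ = tr(AᵀB). Then for every vector v in the column space of Σ, vᵀ Z v ≥ 0; that is, Π_{col(Σ)} Z Π_{col(Σ)} is positive semidefinite, where Π_{col(Σ)} denotes the orthogonal projection matrix onto the column space of Σ. -/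
open scoped Matrix

/-- Let `N` be a norm on `p×p` matrices, monotone for the Loewner order,
`C_M = {Σ ⪰ 0 : N(Σ) ≤ M}`, and let `Z` lie in the normal cone of `C_M` at `Σ ∈ C_M`
(i.e. `⟨Σ' − Σ, Z⟩ ≤ 0` for all `Σ' ∈ C_M`).  Then `vᵀ Z v ≥ 0` for every `v` in the column
space of `Σ`. -/
theorem normal_cone_psd_on_column_space
    (p : ℕ) (hp : 0 < p)
    (N : Matrix (Fin p) (Fin p) ℝ → ℝ)
    (hN0 : ∀ A, N A = 0 ↔ A = 0)
    (hNsmul : ∀ (a : ℝ) A, N (a • A) = |a| * N A)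
    (hNtri : ∀ A B, N (A + B) ≤ N A + N B)
    (hNmono : ∀ A B : Matrix (Fin p) (Fin p) ℝ,
      A.PosSemidef → (B - A).PosSemidef → N A ≤ N B)
    (M : ℝ) (hM : 0 < M)
    (Sg : Matrix (Fin p) (Fin p) ℝ) (hSgPsd : Sg.PosSemidef) (hSgM : N Sg ≤ M)
    (Z : Matrix (Fin p) (Fin p) ℝ)
    (hZ : ∀ Sg' : Matrix (Fin p) (Fin p) ℝ, Sg'.PosSemidef → N Sg' ≤ M →
      Matrix.trace ((Sg' - Sg)ᵀ * Z) ≤ 0) :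
    ∀ v ∈ LinearMap.range Sg.mulVecLin, 0 ≤ v ⬝ᵥ (Z *ᵥ v) := by
  rintro v ⟨w, rfl⟩
  simp only [Matrix.mulVecLin_apply]
  have hsymm : Sgᵀ = Sg := by simpa [Matrix.IsHermitian] using hSgPsd.1
  have hq : ∀ x : Fin p → ℝ, 0 ≤ x ⬝ᵥ (Sg *ᵥ x) := fun x => by
    simpa using hSgPsd.dotProduct_mulVec_nonneg x
  set v := Sg *ᵥ w with hv
  set c := w ⬝ᵥ v with hc
  have hc0 : 0 ≤ c := hq w
  have ht : 0 < (c + 1)⁻¹ := by positivity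
  have htc : (c + 1)⁻¹ * c ≤ 1 := by
    rw [inv_mul_le_iff₀ (by positivity)]; linarith
  set t := (c + 1)⁻¹ with ht_def
  have hvv : (t • Matrix.vecMulVec v v).PosSemidef := by
    have := (Matrix.posSemidef_vecMulVec_self_star v).smul ht.le
    simpa using this
  have hpsd : (Sg - t • Matrix.vecMulVec v v).PosSemidef := by
    refine Matrix.PosSemidef.of_dotProduct_mulVec_nonneg (hSgPsd.1.sub hvv.1) fun x => ?_
    have h1 := hq (x - (t * (x ⬝ᵥ v)) • w)
    have hwx : w ⬝ᵥ (Sg *ᵥ x) = x ⬝ᵥ v := by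
      rw [Matrix.dotProduct_mulVec, ← Matrix.mulVec_transpose, hsymm, dotProduct_comm]
    have hvx : v ⬝ᵥ x = x ⬝ᵥ v := dotProduct_comm _ _
    simp only [Matrix.mulVec_sub, Matrix.mulVec_smul, sub_dotProduct, dotProduct_sub,
      smul_dotProduct, dotProduct_smul, smul_eq_mul, hwx, ← hv, ← hc] at h1
    simp only [star_trivial, Matrix.sub_mulVec, Matrix.smul_mulVec, dotProduct_sub,
      dotProduct_smul, smul_eq_mul, Matrix.vecMulVec_mulVec, hvx, op_smul_eq_smul]
    have h2 : 0 ≤ t * (x ⬝ᵥ v) ^ 2 * (1 - t * c) :=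
      mul_nonneg (by positivity) (by linarith)
    nlinarith
  have hN : N (Sg - t • Matrix.vecMulVec v v) ≤ M :=
    (hNmono _ _ hpsd (by simpa using hvv)).trans hSgM
  have h := hZ _ hpsd hN
  have htr : Matrix.trace ((Sg - t • Matrix.vecMulVec v v - Sg)ᵀ * Z)
      = -(t * (v ⬝ᵥ (Z *ᵥ v))) := by
    rw [sub_sub_cancel_left]
    simp [Matrix.transpose_vecMulVec, Matrix.vecMulVec_mul, Matrix.trace_vecMulVec,
      Matrix.dotProduct_mulVec, dotProduct_comm]
  rw [htr] at h
  exact nonneg_of_mul_nonneg_right (by linarith) ht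
end

section
/- Let p be a positive integer, M > 0, and N a norm on p×p real matrices that is monotone with respect to the positive semidefinite order (0 ⪯ A ⪯ B implies N(A) ≤ N(B)). Let C_M = {Σ : Σ is p×p symmetric positive semidefinite and N(Σ) ≤ M}. Let S be a linear subspace of ℝ^p, let Σ* ∈ C_M with column space col(Σ*) ⊆ S, and let g be a map from p×p real matrices to p×p real matrices that is continuous at Σ* and satisfies the sharpness condition: there exists ρ > 0 such that wᵀ g(Σ*) w ≥ ρ‖w‖₂² for every w ∈ S⊥. Suppose Σ_i is a sequence in C_M converging to Σ*, and Z_i is a sequence of p×p matrices with ⟨Σ' − Σ_i, Z_i⟩ ≤ 0 for every Σ' ∈ C_M and every i (inner product ⟨A,B⟩ = tr(AᵀB)), such that g(Σ_i) + Z_i → 0. Then there exists N₀ such that rank(Σ_i) ≤ dim S for every i ≥ N₀. -/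
open scoped Matrix
open Filter

lemma aux_quad {p : ℕ} (E : Matrix (Fin p) (Fin p) ℝ) (ε : ℝ)
    (hE : ∀ j k, |E j k| ≤ ε) (hε : 0 ≤ ε) (v : Fin p → ℝ) :
    v ⬝ᵥ (E *ᵥ v) ≤ ε * p * (v ⬝ᵥ v) := by
  have h1 : v ⬝ᵥ (E *ᵥ v) ≤ ε * (∑ j, |v j|) ^ 2 := by
    rw [sq, Finset.sum_mul_sum, Finset.mul_sum]
    simp only [dotProduct, Matrix.mulVec, Finset.mul_sum]
    refine Finset.sum_le_sum fun j _ => Finset.sum_le_sum fun k _ => ?_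
    calc v j * (E j k * v k) ≤ |v j * (E j k * v k)| := le_abs_self _
      _ = |E j k| * (|v j| * |v k|) := by rw [abs_mul, abs_mul]; ring
      _ ≤ ε * (|v j| * |v k|) := by gcongr; exact hE j k
  have h2 : (∑ j, |v j|) ^ 2 ≤ p * (v ⬝ᵥ v) := by
    have := sq_sum_le_card_mul_sum_sq (s := (Finset.univ : Finset (Fin p))) (f := fun j => |v j|)
    simpa [dotProduct, sq] using this
  calc _ ≤ _ := h1
    _ ≤ ε * (p * (v ⬝ᵥ v)) := by gcongr
    _ = _ := by ring

lemma aux_psd {p : ℕ} (A : Matrix (Fin p) (Fin p) ℝ) (hA : A.PosSemidef) (u : Fin p → ℝ) :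
    ∃ t : ℝ, 0 < t ∧
      (A - t • Matrix.vecMulVec (A *ᵥ u) (A *ᵥ u)).PosSemidef := by
  obtain ⟨B, rfl⟩ : ∃ B : Matrix (Fin p) (Fin p) ℝ, A = Bᵀ * B := by
    open scoped MatrixOrder ComplexOrder in
    obtain ⟨B, hB⟩ := CStarAlgebra.nonneg_iff_eq_star_mul_self.mp hA.nonneg
    exact ⟨B, by simpa [Matrix.star_eq_conjTranspose] using hB⟩
  set w := B *ᵥ u with hw
  have hv : (Bᵀ * B) *ᵥ u = Bᵀ *ᵥ w := by rw [hw, Matrix.mulVec_mulVec]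
  have hww : 0 ≤ w ⬝ᵥ w := by
    simp only [dotProduct]; exact Finset.sum_nonneg fun i _ => mul_self_nonneg _
  refine ⟨1 / (w ⬝ᵥ w + 1), by positivity, ?_⟩
  rw [hv]
  refine Matrix.PosSemidef.of_dotProduct_mulVec_nonneg ?_ ?_
  · refine hA.1.sub ?_
    ext i j
    simp [Matrix.vecMulVec_apply, mul_comm]
  · intro x
    have e1 : x ⬝ᵥ ((Bᵀ * B) *ᵥ x) = (B *ᵥ x) ⬝ᵥ (B *ᵥ x) := by
      rw [← Matrix.mulVec_mulVec, Matrix.dotProduct_mulVec, Matrix.vecMul_transpose]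
    have e2 : x ⬝ᵥ (Bᵀ *ᵥ w) = (B *ᵥ x) ⬝ᵥ w := by
      rw [Matrix.dotProduct_mulVec, Matrix.vecMul_transpose]
    have e3 : x ⬝ᵥ (Matrix.vecMulVec (Bᵀ *ᵥ w) (Bᵀ *ᵥ w) *ᵥ x) = ((B *ᵥ x) ⬝ᵥ w) ^ 2 := by
      rw [Matrix.vecMulVec_mulVec, ← e2]
      simp [dotProduct_comm _ x, sq]
    have cs : ((B *ᵥ x) ⬝ᵥ w) ^ 2 ≤ ((B *ᵥ x) ⬝ᵥ (B *ᵥ x)) * (w ⬝ᵥ w) := by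
      have := Finset.sum_mul_sq_le_sq_mul_sq Finset.univ (B *ᵥ x) w
      simpa [dotProduct, sq] using this
    have hxx : 0 ≤ (B *ᵥ x) ⬝ᵥ (B *ᵥ x) := by
      simp only [dotProduct]; exact Finset.sum_nonneg fun i _ => mul_self_nonneg _
    rw [star_trivial, Matrix.sub_mulVec, dotProduct_sub, Matrix.smul_mulVec, dotProduct_smul,
      e1, e3, smul_eq_mul, sub_nonneg, div_mul_eq_mul_div, div_le_iff₀ (by positivity)]
    nlinarith

lemma aux_rank {p : ℕ} (A P : Matrix (Fin p) (Fin p) ℝ) (h : P.rank < A.rank) :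
    ∃ u, A *ᵥ u ≠ 0 ∧ P *ᵥ (A *ᵥ u) = 0 := by
  by_contra! hc
  have hinj : Function.Injective
      (P.mulVecLin.rangeRestrict ∘ₗ (LinearMap.range A.mulVecLin).subtype) := by
    rw [injective_iff_map_eq_zero]
    rintro ⟨v, u, rfl⟩ hv
    have hv' : P *ᵥ (A *ᵥ u) = 0 := congrArg Subtype.val hv
    apply Subtype.ext
    by_contra hne
    exact hc u hne hv'
  have := LinearMap.finrank_le_finrank_of_injective hinj
  exact absurd h (not_lt.mpr this)

/-- (Deterministic identifiability.) Let `C_M = {Σ ⪰ 0 : N(Σ) ≤ M}` with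
`N` a Loewner-monotone norm, let the subspace `S` be encoded by its orthogonal projection
matrix `Pr` (symmetric idempotent), let `Σ* ∈ C_M` with `col(Σ*) ⊆ S`, and let `g` be
continuous at `Σ*` with the sharpness property `wᵀ g(Σ*) w ≥ ρ‖w‖²` for all `w ∈ S⊥`.
If `Σᵢ ∈ C_M` converges to `Σ*`, `Zᵢ` lies in the normal cone of `C_M` at `Σᵢ`, and
`g(Σᵢ) + Zᵢ → 0`, then eventually `rank(Σᵢ) ≤ dim S`. -/
theorem sharpness_implies_low_rank_identifiability
    (p : ℕ) (hp : 0 < p)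
    (N : Matrix (Fin p) (Fin p) ℝ → ℝ)
    (hN0 : ∀ A, N A = 0 ↔ A = 0)
    (hNsmul : ∀ (a : ℝ) A, N (a • A) = |a| * N A)
    (hNtri : ∀ A B, N (A + B) ≤ N A + N B)
    (hNmono : ∀ A B : Matrix (Fin p) (Fin p) ℝ,
      A.PosSemidef → (B - A).PosSemidef → N A ≤ N B)
    (M : ℝ) (hM : 0 < M)
    (Pr : Matrix (Fin p) (Fin p) ℝ) (hPrsymm : Pr.IsSymm) (hPridem : Pr * Pr = Pr)
    (Sgstar : Matrix (Fin p) (Fin p) ℝ)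
    (hstarPsd : Sgstar.PosSemidef) (hstarM : N Sgstar ≤ M)
    (hcol : LinearMap.range Sgstar.mulVecLin ≤ LinearMap.range Pr.mulVecLin)
    (g : Matrix (Fin p) (Fin p) ℝ → Matrix (Fin p) (Fin p) ℝ)
    (hg : ContinuousAt g Sgstar)
    (ρ : ℝ) (hρ : 0 < ρ)
    (hsharp : ∀ w : Fin p → ℝ, Pr *ᵥ w = 0 → ρ * (w ⬝ᵥ w) ≤ w ⬝ᵥ (g Sgstar *ᵥ w))
    (Sgseq : ℕ → Matrix (Fin p) (Fin p) ℝ)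
    (hseqPsd : ∀ i, (Sgseq i).PosSemidef) (hseqM : ∀ i, N (Sgseq i) ≤ M)
    (hconv : Tendsto Sgseq atTop (nhds Sgstar))
    (Z : ℕ → Matrix (Fin p) (Fin p) ℝ)
    (hZ : ∀ i, ∀ Sg' : Matrix (Fin p) (Fin p) ℝ, Sg'.PosSemidef → N Sg' ≤ M →
      Matrix.trace ((Sg' - Sgseq i)ᵀ * Z i) ≤ 0)
    (hlim : Tendsto (fun i => g (Sgseq i) + Z i) atTop (nhds 0)) :
    ∃ N₀ : ℕ, ∀ i ≥ N₀, (Sgseq i).rank ≤ Pr.rank := by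
  have hE : Tendsto (fun i => Z i + g Sgstar) atTop (nhds 0) := by
    have h1 : Tendsto (fun i => g (Sgseq i)) atTop (nhds (g Sgstar)) := hg.tendsto.comp hconv
    have h2 := (hlim.sub h1).add_const (g Sgstar)
    simp only [zero_sub, neg_add_cancel] at h2
    refine h2.congr fun i => ?_
    abel
  have hp' : (0 : ℝ) < p := by exact_mod_cast hp
  set ε : ℝ := ρ / (2 * p) with hεdef
  have hε : 0 < ε := by positivity
  have hev : ∀ᶠ i in atTop, ∀ j k, |(Z i + g Sgstar) j k| ≤ ε := by
    rw [eventually_all]; intro j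
    rw [eventually_all]; intro k
    have h3 := tendsto_pi_nhds.mp (tendsto_pi_nhds.mp hE j) k
    have h4 := h3.abs
    simp only [Matrix.zero_apply, abs_zero] at h4
    exact h4.eventually_le_const hε
  obtain ⟨N₀, hN₀⟩ := eventually_atTop.mp hev
  refine ⟨N₀, fun i hi => ?_⟩
  by_contra! hlt
  obtain ⟨u, hne, hPu⟩ := aux_rank _ _ hlt
  obtain ⟨t, ht, hpsd⟩ := aux_psd _ (hseqPsd i) u
  set v := Sgseq i *ᵥ u with hv
  have hvv : 0 < v ⬝ᵥ v := by
    refine lt_of_le_of_ne ?_ (fun h => hne (dotProduct_self_eq_zero.mp h.symm))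
    simp only [dotProduct]; exact Finset.sum_nonneg fun i _ => mul_self_nonneg _
  have hvvpsd : (t • Matrix.vecMulVec v v).PosSemidef := by
    have := (Matrix.posSemidef_vecMulVec_self_star v).smul ht.le
    simpa using this
  have hle := hZ i _ hpsd ((hNmono _ _ hpsd (by simpa using hvvpsd)).trans (hseqM i))
  have htr : Matrix.trace ((Sgseq i - t • Matrix.vecMulVec v v - Sgseq i)ᵀ * Z i)
      = -(t * (v ⬝ᵥ (Z i *ᵥ v))) := by
    rw [sub_sub_cancel_left, Matrix.transpose_neg, Matrix.transpose_smul,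
      Matrix.transpose_vecMulVec, Matrix.neg_mul, Matrix.smul_mul, Matrix.trace_neg,
      Matrix.trace_smul, Matrix.vecMulVec_mul, Matrix.trace_vecMulVec, smul_eq_mul,
      Matrix.dotProduct_mulVec, dotProduct_comm]
  rw [htr] at hle
  have hZv : 0 ≤ v ⬝ᵥ (Z i *ᵥ v) := by
    by_contra! h
    nlinarith [mul_neg_of_pos_of_neg ht h]
  have hq := aux_quad _ ε (hN₀ i hi) hε.le v
  rw [Matrix.add_mulVec, dotProduct_add] at hq
  have hs := hsharp v hPu
  have he : ε * p = ρ / 2 := by rw [hεdef]; field_simp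
  rw [he] at hq
  nlinarith [mul_pos hρ hvv]
end

section
/- Let p be a positive integer and let Σ_i be a sequence of p×p real symmetric positive semidefinite matrices converging to a symmetric positive semidefinite matrix Σ, with rank(Σ_i) = rank(Σ) for every i. Let P_i and P be the (unique) symmetric idempotent p×p matrices whose column spaces equal the column spaces of Σ_i and Σ respectively (i.e., the orthogonal projection matrices onto col(Σ_i) and col(Σ)). Then P_i → P. -/
open scoped Matrix
open Filter

theorem aux_trace_idem {p : ℕ} (P : Matrix (Fin p) (Fin p) ℝ) (h : P * P = P) :
    P.trace = (P.rank : ℝ) := by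
  have h1 : IsIdempotentElem (Matrix.toLin' P) := by
    unfold IsIdempotentElem
    rw [Module.End.mul_eq_comp, ← Matrix.toLin'_mul, h]
  have h2 := (LinearMap.IsIdempotentElem.isProj_range _ h1).trace
  rw [Matrix.trace_toLin'_eq] at h2
  exact h2

theorem aux_fix {p : ℕ} (P S : Matrix (Fin p) (Fin p) ℝ) (h : P * P = P)
    (hc : LinearMap.range P.mulVecLin = LinearMap.range S.mulVecLin) : P * S = S := by
  apply Matrix.toLin'.injective
  ext1 j
  ext1
  simp only [LinearMap.comp_apply, Matrix.toLin'_apply]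
  set x := (LinearMap.single ℝ (fun _ : Fin p => ℝ) j) 1
  have : S *ᵥ x ∈ LinearMap.range P.mulVecLin := by
    rw [hc]; exact ⟨x, rfl⟩
  obtain ⟨y, hy⟩ := this
  rw [Matrix.mulVecLin_apply] at hy
  rw [← Matrix.mulVec_mulVec, ← hy, Matrix.mulVec_mulVec, h]

theorem aux_factor {p : ℕ} (P S : Matrix (Fin p) (Fin p) ℝ)
    (hc : LinearMap.range P.mulVecLin = LinearMap.range S.mulVecLin) :
    ∃ B : Matrix (Fin p) (Fin p) ℝ, P = S * B := by
  have h : ∀ j, ∃ y, S *ᵥ y = P.col j := by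
    intro j
    have : P.col j ∈ LinearMap.range S.mulVecLin := by
      rw [← hc]; exact ⟨Pi.single j 1, by simp⟩
    exact this
  choose y hy using h
  refine ⟨Matrix.of fun k j => y j k, ?_⟩
  ext i j
  have := congrFun (hy j) i
  simp only [Matrix.col_apply] at this
  rw [← this]
  rfl

theorem aux_bound {p : ℕ} (P : Matrix (Fin p) (Fin p) ℝ) (hs : P.IsSymm) (h : P * P = P)
    (j k : Fin p) : |P j k| ≤ 1 := by
  have h1 : ∑ l, P j l ^ 2 = P j j := by
    conv_rhs => rw [← h, Matrix.mul_apply]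
    refine Finset.sum_congr rfl fun l _ => ?_
    rw [hs.apply j l, sq]
  have h2 : ∀ l, P j l ^ 2 ≤ P j j := fun l => by
    rw [← h1]
    exact Finset.single_le_sum (f := fun l => P j l ^ 2) (fun _ _ => sq_nonneg _)
      (Finset.mem_univ l)
  have h3 := h2 j
  have h4 := h2 k
  rw [abs_le_one_iff_mul_self_le_one]
  nlinarith

theorem aux_sq {p : ℕ} (P Q : Matrix (Fin p) (Fin p) ℝ) (hP : P.IsSymm) (hQ : Q.IsSymm)
    (hPi : P * P = P) (hQi : Q * Q = Q) (j k : Fin p) :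
    (P j k - Q j k) ^ 2 ≤ P.trace + Q.trace - 2 * (P * Q).trace := by
  have e : ((P - Q) * (P - Q)).trace = P.trace + Q.trace - 2 * (P * Q).trace := by
    rw [sub_mul, mul_sub, mul_sub, hPi, hQi]
    simp only [Matrix.trace_sub]
    rw [Matrix.trace_mul_comm Q P]; ring
  have e2 : ((P - Q) * (P - Q)).trace = ∑ a, ∑ b, (P a b - Q a b) ^ 2 := by
    simp only [Matrix.trace, Matrix.diag_apply, Matrix.mul_apply, Matrix.sub_apply]
    refine Finset.sum_congr rfl fun a _ => Finset.sum_congr rfl fun b _ => ?_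
    rw [hP.apply a b, hQ.apply a b, sq]
  rw [← e, e2]
  refine le_trans ?_ (Finset.single_le_sum (f := fun a => ∑ b, (P a b - Q a b) ^ 2)
    (fun _ _ => Finset.sum_nonneg fun _ _ => sq_nonneg _) (Finset.mem_univ j))
  exact Finset.single_le_sum (f := fun b => (P j b - Q j b) ^ 2)
    (fun _ _ => sq_nonneg _) (Finset.mem_univ k)

/-- If PSD matrices `Σᵢ → Σ` with `rank Σᵢ = rank Σ`, then the orthogonal
projection matrices onto their column spaces (the unique symmetric idempotent matrices with
the same column spaces) converge: `Pᵢ → P`. -/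
theorem projections_converge_of_rank_stable
    (p : ℕ) (hp : 0 < p)
    (Sgseq : ℕ → Matrix (Fin p) (Fin p) ℝ) (Sg : Matrix (Fin p) (Fin p) ℝ)
    (hseqPsd : ∀ i, (Sgseq i).PosSemidef) (hSgPsd : Sg.PosSemidef)
    (hconv : Tendsto Sgseq atTop (nhds Sg))
    (hrank : ∀ i, (Sgseq i).rank = Sg.rank)
    (Pseq : ℕ → Matrix (Fin p) (Fin p) ℝ) (Pr : Matrix (Fin p) (Fin p) ℝ)
    (hPseqSymm : ∀ i, (Pseq i).IsSymm)
    (hPseqIdem : ∀ i, Pseq i * Pseq i = Pseq i)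
    (hPseqCol : ∀ i, LinearMap.range (Pseq i).mulVecLin
      = LinearMap.range (Sgseq i).mulVecLin)
    (hPrSymm : Pr.IsSymm) (hPrIdem : Pr * Pr = Pr)
    (hPrCol : LinearMap.range Pr.mulVecLin = LinearMap.range Sg.mulVecLin) :
    Tendsto Pseq atTop (nhds Pr) := by
  obtain ⟨B, hB⟩ := aux_factor Pr Sg hPrCol
  have hrk : ∀ i, (Pseq i).trace = Pr.trace := by
    intro i
    rw [aux_trace_idem _ (hPseqIdem i), aux_trace_idem _ hPrIdem]
    have h1 : (Pseq i).rank = (Sgseq i).rank := by unfold Matrix.rank; rw [hPseqCol i]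
    have h2 : Pr.rank = Sg.rank := by unfold Matrix.rank; rw [hPrCol]
    rw [h1, h2, hrank i]
  have hdec : ∀ i, (Pseq i * Pr).trace
      = (Sgseq i * B).trace + (Pseq i * ((Sg - Sgseq i) * B)).trace := by
    intro i
    have h := aux_fix _ _ (hPseqIdem i) (hPseqCol i)
    rw [← Matrix.trace_add, sub_mul, mul_sub, ← mul_assoc _ (Sgseq i), h, ← hB]
    simp
  have hD : Tendsto (fun i => (Sg - Sgseq i) * B) atTop (nhds 0) := by
    have h := (tendsto_const_nhds (x := Sg)).sub hconv
    have h' := h.mul (tendsto_const_nhds (x := B))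
    simpa using h'
  have hz : Tendsto (fun i => (Pseq i * ((Sg - Sgseq i) * B)).trace) atTop (nhds 0) := by
    simp only [Matrix.trace, Matrix.diag_apply, Matrix.mul_apply (M := Pseq _)]
    rw [show (0 : ℝ) = ∑ a : Fin p, ∑ b : Fin p, (0 : ℝ) by simp]
    refine tendsto_finsetSum _ fun a _ => tendsto_finsetSum _ fun b _ => ?_
    have hD' : Tendsto (fun i => ((Sg - Sgseq i) * B) b a) atTop (nhds 0) :=
      tendsto_pi_nhds.1 (tendsto_pi_nhds.1 hD b) a
    refine squeeze_zero_norm (fun i => ?_) (by simpa using hD'.norm)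
    rw [norm_mul]
    exact mul_le_of_le_one_left (norm_nonneg _) (aux_bound _ (hPseqSymm i) (hPseqIdem i) a b)
  have ht : Tendsto (fun i => (Pseq i * Pr).trace) atTop (nhds Pr.trace) := by
    simp only [hdec]
    have h1 : Tendsto (fun i => (Sgseq i * B).trace) atTop (nhds (Sg * B).trace) :=
      ((continuous_id.matrix_mul continuous_const).matrix_trace.tendsto Sg).comp hconv
    rw [← hB] at h1
    simpa using h1.add hz
  have hs : Tendsto (fun i => (Pseq i).trace + Pr.trace - 2 * (Pseq i * Pr).trace) atTop
      (nhds 0) := by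
    simp only [hrk]
    have := (ht.const_mul 2).const_sub (Pr.trace + Pr.trace)
    convert this using 2
    ring
  refine tendsto_pi_nhds.2 fun j => tendsto_pi_nhds.2 fun k => ?_
  have hsq : Tendsto (fun i => (Pseq i j k - Pr j k) ^ 2) atTop (nhds 0) :=
    squeeze_zero (fun _ => sq_nonneg _)
      (fun i => aux_sq _ _ (hPseqSymm i) hPrSymm (hPseqIdem i) hPrIdem j k) hs
  rw [tendsto_iff_norm_sub_tendsto_zero]
  have := hsq.sqrt
  simpa [Real.sqrt_sq_eq_abs] using this
end

section
/- Let k be a positive integer, Y an arbitrary set, c : ℝ^k × Y → ℝ, x₀ ∈ ℝ^k, and 𝒩 an open neighborhood of x₀. Let y : ℝ^k → Y be such that for every x ∈ 𝒩 and every y' ∈ Y, c(x, y(x)) ≤ c(x, y'), and define v(x) = c(x, y(x)). Suppose there is a map g : 𝒩 × 𝒩 → ℝ^k such that for all x', x'' ∈ 𝒩, the function x ↦ c(x, y(x'')) has gradient g(x', x'') at x', and suppose g(x', x'') → g(x₀, x₀) as (x', x'') → (x₀, x₀). Then v is differentiable at x₀ with gradient ∇v(x₀) = g(x₀, x₀),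 i.e., v(x) = v(x₀) + ⟨g(x₀,x₀), x − x₀⟩ + o(‖x − x₀‖) as x → x₀. -/
open Filter

/-- (Envelope theorem.) Let `v(x) = c(x, y(x))` where `y(x)` minimizes
`c(x, ·)` for every `x` in an open neighborhood `𝒩` of `x₀`. If `x ↦ c(x, y(x''))` has
gradient `g(x', x'')` at each `x' ∈ 𝒩` for each `x'' ∈ 𝒩`, and `g(x',x'') → g(x₀,x₀)` as
`(x',x'') → (x₀,x₀)`, then `v` is differentiable at `x₀` with gradient `g(x₀, x₀)`. -/
theorem envelope_theorem
    (k : ℕ) (hk : 0 < k)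
    (Y : Type*) [Nonempty Y]
    (c : EuclideanSpace ℝ (Fin k) → Y → ℝ)
    (x₀ : EuclideanSpace ℝ (Fin k))
    (𝒩 : Set (EuclideanSpace ℝ (Fin k))) (h𝒩 : IsOpen 𝒩) (hx₀ : x₀ ∈ 𝒩)
    (y : EuclideanSpace ℝ (Fin k) → Y)
    (hy : ∀ x ∈ 𝒩, ∀ y' : Y, c x (y x) ≤ c x y')
    (g : EuclideanSpace ℝ (Fin k) → EuclideanSpace ℝ (Fin k) → EuclideanSpace ℝ (Fin k))
    (hgrad : ∀ x' ∈ 𝒩, ∀ x'' ∈ 𝒩, HasGradientAt (fun x => c x (y x'')) (g x' x'') x')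
    (hcont : Tendsto (fun q : EuclideanSpace ℝ (Fin k) × EuclideanSpace ℝ (Fin k) =>
      g q.1 q.2) (nhds (x₀, x₀)) (nhds (g x₀ x₀))) :
    HasGradientAt (fun x => c x (y x)) (g x₀ x₀) x₀ := by
  rw [hasGradientAt_iff_hasFDerivAt]
  apply HasFDerivAt.of_isLittleO
  rw [Asymptotics.isLittleO_iff]
  intro ε hε
  rw [Metric.tendsto_nhds_nhds] at hcont
  obtain ⟨δ, hδ, hg⟩ := hcont ε hε
  obtain ⟨r, hr, hrN⟩ := Metric.isOpen_iff.1 h𝒩 x₀ hx₀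
  have hm : 0 < min δ r := lt_min hδ hr
  have h0 : x₀ ∈ Metric.ball x₀ (min δ r) := Metric.mem_ball_self hm
  have hsub : ∀ z ∈ Metric.ball x₀ (min δ r), z ∈ 𝒩 := fun z hz =>
    hrN (Metric.ball_subset_ball (min_le_right _ _) hz)
  have key : ∀ w ∈ Metric.ball x₀ (min δ r), ∀ x ∈ Metric.ball x₀ (min δ r),
      ‖c x (y w) - c x₀ (y w) - InnerProductSpace.toDual ℝ _ (g x₀ x₀) (x - x₀)‖
        ≤ ε * ‖x - x₀‖ := by
    intro w hw x hx
    refine (convex_ball x₀ (min δ r)).norm_image_sub_le_of_norm_hasFDerivWithin_le'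
      (f := fun z => c z (y w)) (f' := fun z => InnerProductSpace.toDual ℝ _ (g z w))
      (fun z hz => ((hgrad z (hsub z hz) w (hsub w hw)).hasFDerivAt).hasFDerivWithinAt)
      (fun z hz => ?_) h0 hx
    rw [← map_sub, LinearIsometryEquiv.norm_map, ← dist_eq_norm]
    refine (hg (x := (z, w)) ?_).le
    rw [Prod.dist_eq]
    exact max_lt (lt_of_lt_of_le hz (min_le_left _ _)) (lt_of_lt_of_le hw (min_le_left _ _))
  filter_upwards [Metric.ball_mem_nhds x₀ hm] with x hx
  have h1 := abs_le.1 (key x hx x hx)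
  have h2 := abs_le.1 (key x₀ h0 x hx)
  have h3 := hy x (hsub x hx) (y x₀)
  have h4 := hy x₀ hx₀ (y x)
  rw [Real.norm_eq_abs, abs_le]
  constructor
  · linarith [h1.1]
  · linarith [h2.2]
end

section
/- Let p be a positive integer and let C denote the set of p×p real symmetric positive semidefinite matrices, a subset of the space of p×p real matrices equipped with the Frobenius inner product ⟨A,B⟩ = tr(AᵀB) and Frobenius norm ‖·‖_F. Let f : C → ℝ be continuous on C, and let w be a map from p×p matrices to p×p symmetric matrices that is continuous on C and such that for every positive definite Σ, f is differentiable at Σ with gradient w(Σ) (with respect to the Frobenius inner product). Then for every Σ ∈ C and every sequence Σ_n ∈ C converging to Σ, f(Σ_n) = f(Σ) + ⟨w(Σ), Σ_n − Σ⟩ + o(‖Σ_n − Σ‖_F). -/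
open Filter Asymptotics
open scoped Matrix

section Helpers

lemma tendsto_add_smul_vec {E : Type*} [NormedAddCommGroup E] [NormedSpace ℝ E] (A e : E) :
    Tendsto (fun t : ℝ => A + t • e) (nhdsWithin 0 (Set.Ioi 0)) (nhds A) := by
  have h : Continuous (fun t : ℝ => A + t • e) := by fun_prop
  have h2 := h.tendsto 0
  simp only [zero_smul, add_zero] at h2
  exact h2.mono_left nhdsWithin_le_nhds

/-- Abstract version: `P` is a convex set (the "interior"), `Q` a larger set which is pushed into
`P` by moving in direction `e`. -/
lemma gradient_abstract {E : Type*} [NormedAddCommGroup E] [NormedSpace ℝ E]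
    [FiniteDimensional ℝ E] (P Q : Set E) (e : E) (hP : Convex ℝ P) (hPQ : P ⊆ Q)
    (hadd : ∀ A ∈ Q, ∀ t : ℝ, 0 < t → A + t • e ∈ P)
    (B : E →ₗ[ℝ] (E →ₗ[ℝ] ℝ)) (f : E → ℝ) (hf : ContinuousOn f Q) (w : E → E)
    (hw : ContinuousOn w Q)
    (hgrad : ∀ S ∈ P, (fun A => f A - f S - B (w S) (A - S)) =o[nhds S] (fun A => ‖A - S‖))
    (S : E) (hS : S ∈ Q) (u : ℕ → E) (hu : ∀ n, u n ∈ Q) (hconv : Tendsto u atTop (nhds S)) :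
    (fun n => f (u n) - f S - B (w S) (u n - S)) =o[atTop] (fun n => ‖u n - S‖) := by
  let L : E →ₗ[ℝ] (E →L[ℝ] ℝ) :=
    (LinearMap.toContinuousLinearMap (𝕜 := ℝ) (E := E) (F' := ℝ)).toLinearMap ∘ₗ B
  have hL : Continuous L := LinearMap.continuous_of_finiteDimensional _
  have hLw : ContinuousOn (fun A => L (w A)) Q := hL.comp_continuousOn hw
  have hder : ∀ X ∈ P, HasFDerivAt f (L (w X)) X := fun X hX =>
    HasFDerivAt.of_isLittleO (hgrad X hX).of_norm_right
  refine IsLittleO.of_bound fun c hc => ?_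
  obtain ⟨δ, hδ, hball⟩ := Metric.continuousWithinAt_iff.1 (hLw S hS) c hc
  filter_upwards [hconv.eventually (Metric.ball_mem_nhds S hδ)] with n hn
  rw [norm_norm]
  have hA := hu n
  generalize u n = A at hA hn
  have hconvex : Convex ℝ (P ∩ Metric.ball S δ) := hP.inter (convex_ball S δ)
  have hbound : ∀ᶠ t in nhdsWithin (0 : ℝ) (Set.Ioi 0),
      ‖f (A + t • e) - f (S + t • e) - L (w S) (A - S)‖ ≤ c * ‖A - S‖ := by
    filter_upwards [self_mem_nhdsWithin,
      (tendsto_add_smul_vec A e).eventually (Metric.isOpen_ball.mem_nhds hn),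
      (tendsto_add_smul_vec S e).eventually (Metric.ball_mem_nhds S hδ)] with t ht h1 h2
    have := hconvex.norm_image_sub_le_of_norm_hasFDerivWithin_le'
      (f := f) (f' := fun X => L (w X)) (φ := L (w S)) (C := c)
      (fun X hX => (hder X hX.1).hasFDerivWithinAt)
      (fun X hX => by
        have := hball (hPQ hX.1) hX.2
        rw [dist_eq_norm] at this
        exact this.le)
      (x := S + t • e) (y := A + t • e)
      ⟨hadd S hS t ht, h2⟩ ⟨hadd A hA t ht, h1⟩
    rwa [add_sub_add_right_eq_sub] at this
  have hlim : ∀ X ∈ Q, Tendsto (fun t : ℝ => f (X + t • e))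
        (nhdsWithin 0 (Set.Ioi 0)) (nhds (f X)) := by
    intro X hX
    refine (hf X hX).tendsto.comp (tendsto_nhdsWithin_iff.2 ⟨tendsto_add_smul_vec X e, ?_⟩)
    filter_upwards [self_mem_nhdsWithin] with t ht
    exact hPQ (hadd X hX t ht)
  exact le_of_tendsto (((hlim A hA).sub (hlim S hS)).sub_const _).norm hbound

/-- The Frobenius pairing, as a bilinear map. -/
noncomputable def frobPairing (p : ℕ) :
    Matrix (Fin p) (Fin p) ℝ →ₗ[ℝ] (Matrix (Fin p) (Fin p) ℝ →ₗ[ℝ] ℝ) where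
  toFun W :=
    { toFun := fun A => Matrix.trace (Wᵀ * A)
      map_add' := fun A B => by rw [mul_add, Matrix.trace_add]
      map_smul' := fun c A => by simp }
  map_add' U V := by
    refine LinearMap.ext fun A => ?_
    simp [add_mul]
  map_smul' c U := by
    refine LinearMap.ext fun A => ?_
    simp

lemma convex_posDef (p : ℕ) : Convex ℝ {A : Matrix (Fin p) (Fin p) ℝ | A.PosDef} := by
  rw [convex_iff_forall_pos]
  intro A hA B hB a b ha hb _
  exact (Matrix.PosDef.smul hA ha).add (Matrix.PosDef.smul hB hb)

lemma posDef_add_smul_one {p : ℕ} {A : Matrix (Fin p) (Fin p) ℝ} (hA : A.PosSemidef)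
    {t : ℝ} (ht : 0 < t) : (A + t • (1 : Matrix (Fin p) (Fin p) ℝ)).PosDef :=
  Matrix.PosDef.posSemidef_add hA (Matrix.PosDef.smul Matrix.PosDef.one ht)

attribute [local instance] Matrix.frobeniusNormedAddCommGroup Matrix.frobeniusNormedSpace

lemma sqrt_trace_eq_frobenius {p : ℕ} (A : Matrix (Fin p) (Fin p) ℝ) :
    Real.sqrt (Matrix.trace (Aᵀ * A)) = ‖A‖ := by
  rw [Matrix.frobenius_norm_def, ← Real.sqrt_eq_rpow]
  congr 1
  simp only [Matrix.trace, Matrix.diag, Matrix.mul_apply, Matrix.transpose_apply]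
  rw [Finset.sum_comm]
  refine Finset.sum_congr rfl fun i _ => Finset.sum_congr rfl fun j _ => ?_
  rw [Real.rpow_two, Real.norm_eq_abs, sq_abs, sq]

lemma gradient_main {p : ℕ}
    (f : Matrix (Fin p) (Fin p) ℝ → ℝ)
    (hf : ContinuousOn f {A : Matrix (Fin p) (Fin p) ℝ | A.PosSemidef})
    (w : Matrix (Fin p) (Fin p) ℝ → Matrix (Fin p) (Fin p) ℝ)
    (hwcont : ContinuousOn w {A : Matrix (Fin p) (Fin p) ℝ | A.PosSemidef})
    (hgrad : ∀ Sg : Matrix (Fin p) (Fin p) ℝ, Sg.PosDef →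
      (fun A => f A - f Sg - Matrix.trace ((w Sg)ᵀ * (A - Sg)))
        =o[nhds Sg] (fun A => Real.sqrt (Matrix.trace ((A - Sg)ᵀ * (A - Sg)))))
    (Sg : Matrix (Fin p) (Fin p) ℝ) (hSg : Sg.PosSemidef)
    (Sgseq : ℕ → Matrix (Fin p) (Fin p) ℝ) (hseqPsd : ∀ n, (Sgseq n).PosSemidef)
    (hconv : Tendsto Sgseq atTop (nhds Sg)) :
    (fun n => f (Sgseq n) - f Sg - Matrix.trace ((w Sg)ᵀ * (Sgseq n - Sg)))
      =o[atTop] (fun n => Real.sqrt (Matrix.trace ((Sgseq n - Sg)ᵀ * (Sgseq n - Sg)))) := by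
  simp only [sqrt_trace_eq_frobenius] at hgrad ⊢
  exact gradient_abstract {A : Matrix (Fin p) (Fin p) ℝ | A.PosDef}
    {A : Matrix (Fin p) (Fin p) ℝ | A.PosSemidef} 1 (convex_posDef p)
    (fun A hA => Matrix.PosDef.posSemidef hA) (fun A hA t ht => posDef_add_smul_one hA ht)
    (frobPairing p) f hf w hwcont hgrad Sg hSg Sgseq hseqPsd hconv

end Helpers

/-- Let `C` be the PSD cone with the Frobenius inner product
`⟨A,B⟩ = tr(AᵀB)`. If `f : C → ℝ` is continuous on `C`, `w` is continuous on `C` with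
symmetric values, and `f` has gradient `w(Σ)` at every positive definite `Σ`, then for
every `Σ ∈ C` and every sequence `Σₙ ∈ C` with `Σₙ → Σ`,
`f(Σₙ) = f(Σ) + ⟨w(Σ), Σₙ − Σ⟩ + o(‖Σₙ − Σ‖_F)`. -/
theorem gradient_extends_to_psd_boundary
    (p : ℕ) (hp : 0 < p)
    (f : Matrix (Fin p) (Fin p) ℝ → ℝ)
    (hf : ContinuousOn f {A : Matrix (Fin p) (Fin p) ℝ | A.PosSemidef})
    (w : Matrix (Fin p) (Fin p) ℝ → Matrix (Fin p) (Fin p) ℝ)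
    (hwsymm : ∀ A, (w A).IsSymm)
    (hwcont : ContinuousOn w {A : Matrix (Fin p) (Fin p) ℝ | A.PosSemidef})
    (hgrad : ∀ Sg : Matrix (Fin p) (Fin p) ℝ, Sg.PosDef →
      (fun A => f A - f Sg - Matrix.trace ((w Sg)ᵀ * (A - Sg)))
        =o[nhds Sg] (fun A => Real.sqrt (Matrix.trace ((A - Sg)ᵀ * (A - Sg)))))
    (Sg : Matrix (Fin p) (Fin p) ℝ) (hSg : Sg.PosSemidef)
    (Sgseq : ℕ → Matrix (Fin p) (Fin p) ℝ) (hseqPsd : ∀ n, (Sgseq n).PosSemidef)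
    (hconv : Tendsto Sgseq atTop (nhds Sg)) :
    (fun n => f (Sgseq n) - f Sg - Matrix.trace ((w Sg)ᵀ * (Sgseq n - Sg)))
      =o[atTop] (fun n => Real.sqrt (Matrix.trace ((Sgseq n - Sg)ᵀ * (Sgseq n - Sg)))) := by
  exact gradient_main f hf w hwcont hgrad Sg hSg Sgseq hseqPsd hconv
end

section
/- Let p be a positive integer, let m > 0, let μ be a finite (nonnegative) measure on ℝ supported in [m, ∞), and let Σ be a p×p real symmetric positive definite matrix. Define Q_Σ : ℝ^p → ℝ by Q_Σ(ω) = ∫ (det Σ)^{−1/2} · (4πt)^{−p/2} · exp(−(1/(4t)) · ωᵀ Σ^{−1} ω) dμ(t). Then Q_Σ is nonnegative and Lebesgue-integrable on ℝ^p, and for every z ∈ ℝ^p, ∫_{ℝ^p} e^{i⟨ω, z⟩} Q_Σ(ω) dω = ∫ e^{−t · zᵀΣz} dμ(t) = φ(zᵀΣz), where φ(s) = ∫ e^{−ts} dμ(t). In other words, the inverse Fourier transform of Q_Σ equals the function z ↦ φ(‖z‖²_Σ) with ‖z‖²_Σ = zᵀΣz. -/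
open scoped Matrix
open MeasureTheory Real

lemma gm_cov {p : ℕ} (B : Matrix (Fin p) (Fin p) ℝ) (hB : B.det ≠ 0) (f : (Fin p → ℝ) → ℂ) :
    (Integrable (fun y => f (B *ᵥ y)) → Integrable f) ∧
    (∫ y, f (B *ᵥ y)) = ((|B.det|⁻¹ : ℝ) : ℂ) * ∫ ω, f ω := by
  have hmap := Real.map_matrix_volume_pi_eq_smul_volume_pi hB
  have hinj : Function.Injective (Matrix.toLin' B) := by
    have : Function.Injective B.mulVec :=
      Matrix.mulVec_injective_iff_isUnit.2 ((Matrix.isUnit_iff_isUnit_det _).2 hB.isUnit)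
    exact this
  have hemb : MeasurableEmbedding (Matrix.toLin' B) :=
    (LinearMap.continuous_of_finiteDimensional _).measurableEmbedding hinj
  have hpos : 0 < |B.det|⁻¹ := by positivity
  constructor
  · intro h
    have h1 : Integrable f (Measure.map (Matrix.toLin' B) volume) := by
      rw [hemb.integrable_map_iff]
      exact h
    rw [hmap, integrable_smul_measure (by simpa using hB) ENNReal.ofReal_ne_top] at h1
    exact h1
  · have h1 := hemb.integral_map (μ := volume) f
    rw [hmap, integral_smul_measure, ENNReal.toReal_ofReal (abs_nonneg _), abs_inv] at h1
    simp only [Matrix.toLin'_apply] at h1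
    rw [← h1, Complex.real_smul]

lemma gm_key {p : ℕ} (Sg : Matrix (Fin p) (Fin p) ℝ) (hSg : Sg.PosDef) (t : ℝ) (ht : 0 < t)
    (z : Fin p → ℝ) :
    Integrable (fun ω : Fin p → ℝ => Complex.exp (Complex.I * ((ω ⬝ᵥ z : ℝ) : ℂ)) *
      (((Real.sqrt Sg.det)⁻¹ * (4 * π * t) ^ (-(p : ℝ) / 2)
        * Real.exp (-(1 / (4 * t)) * (ω ⬝ᵥ (Sg⁻¹ *ᵥ ω))) : ℝ) : ℂ)) ∧
    ∫ ω : Fin p → ℝ, Complex.exp (Complex.I * ((ω ⬝ᵥ z : ℝ) : ℂ)) *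
      (((Real.sqrt Sg.det)⁻¹ * (4 * π * t) ^ (-(p : ℝ) / 2)
        * Real.exp (-(1 / (4 * t)) * (ω ⬝ᵥ (Sg⁻¹ *ᵥ ω))) : ℝ) : ℂ)
      = ((Real.exp (-t * (z ⬝ᵥ (Sg *ᵥ z))) : ℝ) : ℂ) := by
  obtain ⟨A, hA⟩ : ∃ A : Matrix (Fin p) (Fin p) ℝ, Sg = Aᵀ * A := by
    open scoped MatrixOrder in
    obtain ⟨A, hA⟩ := CStarAlgebra.nonneg_iff_eq_star_mul_self.mp hSg.posSemidef.nonneg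
    exact ⟨A, by rw [hA, Matrix.star_eq_conjTranspose, Matrix.conjTranspose_eq_transpose_of_trivial]⟩
  have hdet : Sg.det = A.det ^ 2 := by rw [hA, Matrix.det_mul, Matrix.det_transpose]; ring
  have hAd : A.det ≠ 0 := by
    intro h
    have := hSg.det_pos
    rw [hdet, h] at this
    simp at this
  have hBd : Aᵀ.det ≠ 0 := by rwa [Matrix.det_transpose]
  have hquad : ∀ y : Fin p → ℝ, (Aᵀ *ᵥ y) ⬝ᵥ (Sg⁻¹ *ᵥ (Aᵀ *ᵥ y)) = ∑ i, y i ^ 2 := by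
    intro y
    have e : Sg⁻¹ *ᵥ (Aᵀ *ᵥ y) = A⁻¹ *ᵥ y := by
      rw [Matrix.mulVec_mulVec, hA, Matrix.mul_inv_rev, Matrix.mul_assoc,
        Matrix.nonsing_inv_mul _ hBd.isUnit, Matrix.mul_one]
    rw [e, Matrix.mulVec_transpose, ← Matrix.dotProduct_mulVec, Matrix.mulVec_mulVec,
      Matrix.mul_nonsing_inv _ hAd.isUnit, Matrix.one_mulVec]
    simp [dotProduct, sq]
  have hlin : ∀ y : Fin p → ℝ, (Aᵀ *ᵥ y) ⬝ᵥ z = ∑ i, (A *ᵥ z) i * y i := by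
    intro y
    rw [Matrix.mulVec_transpose, ← Matrix.dotProduct_mulVec, dotProduct_comm]
    rfl
  have hz : z ⬝ᵥ (Sg *ᵥ z) = ∑ i, (A *ᵥ z) i ^ 2 := by
    rw [hA, ← Matrix.mulVec_mulVec, Matrix.mulVec_transpose, dotProduct_comm,
      ← Matrix.dotProduct_mulVec]
    simp [dotProduct, sq]
  have hb : 0 < (((1 / (4 * t) : ℝ) : ℂ)).re := by
    rw [Complex.ofReal_re]; positivity
  set f : (Fin p → ℝ) → ℂ := fun ω => Complex.exp (Complex.I * ((ω ⬝ᵥ z : ℝ) : ℂ)) *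
      (((Real.sqrt Sg.det)⁻¹ * (4 * π * t) ^ (-(p : ℝ) / 2)
        * Real.exp (-(1 / (4 * t)) * (ω ⬝ᵥ (Sg⁻¹ *ᵥ ω))) : ℝ) : ℂ) with hf
  set C : ℝ := (Real.sqrt Sg.det)⁻¹ * (4 * π * t) ^ (-(p : ℝ) / 2) with hC
  have hcomp : (fun y => f (Aᵀ *ᵥ y)) = fun y : Fin p → ℝ => (C : ℂ) *
      Complex.exp (-((1 / (4 * t) : ℝ) : ℂ) * ∑ i, (y i : ℂ) ^ 2
        + ∑ i, (Complex.I * ((A *ᵥ z) i : ℂ)) * (y i : ℂ)) := by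
    funext y
    simp only [hf, hquad, hlin]
    rw [Complex.exp_add, Complex.ofReal_mul C, Complex.ofReal_exp]
    simp only [mul_assoc, ← Finset.mul_sum]
    push_cast
    ring
  obtain ⟨h1, h2⟩ := gm_cov Aᵀ hBd f
  refine ⟨h1 ?_, ?_⟩
  · rw [hcomp]
    exact (GaussianFourier.integrable_cexp_neg_mul_sum_add hb _).const_mul _
  · rw [hcomp, integral_const_mul, GaussianFourier.integral_cexp_neg_mul_sum_add hb] at h2
    rw [Matrix.det_transpose] at h2
    have habs : Real.sqrt Sg.det = |A.det| := by rw [hdet, Real.sqrt_sq_eq_abs]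
    have hne : ((|A.det|⁻¹ : ℝ) : ℂ) ≠ 0 := by
      rw [Complex.ofReal_ne_zero]; positivity
    apply mul_left_cancel₀ hne
    rw [← h2, hC, habs, hz]
    have e1 : ((π : ℂ) / ((1 / (4 * t) : ℝ) : ℂ)) ^ ((Fintype.card (Fin p) : ℂ) / 2)
        = (((4 * π * t) ^ ((p : ℝ) / 2) : ℝ) : ℂ) := by
      rw [Complex.ofReal_cpow (by positivity)]
      congr 1
      · push_cast
        field_simp
      · simp
    have e2 : (∑ i, (Complex.I * ((A *ᵥ z) i : ℂ)) ^ 2) / (4 * ((1 / (4 * t) : ℝ) : ℂ))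
        = ((-t * ∑ i, (A *ᵥ z) i ^ 2 : ℝ) : ℂ) := by
      simp only [mul_pow, Complex.I_sq, ← Finset.mul_sum]
      have : (t : ℂ) ≠ 0 := by exact_mod_cast ht.ne'
      push_cast
      field_simp
    have e3 : (4 * π * t) ^ (-(p : ℝ) / 2) * (4 * π * t) ^ ((p : ℝ) / 2) = 1 := by
      rw [← Real.rpow_add (by positivity), neg_div, neg_add_cancel, Real.rpow_zero]
    rw [e1, e2, ← Complex.ofReal_exp]
    rw [← Complex.ofReal_mul, ← Complex.ofReal_mul, ← Complex.ofReal_mul]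
    congr 1
    rw [mul_assoc, ← mul_assoc _ _ (Real.exp _), e3, one_mul]

/-- For a finite measure `μ` supported in `[m, ∞)` with `m > 0` and a
positive definite `Σ`, the function
`Q_Σ(ω) = ∫ (det Σ)^{−1/2} (4πt)^{−p/2} exp(−(1/(4t)) ωᵀΣ⁻¹ω) dμ(t)` is nonnegative and
Lebesgue-integrable on `ℝ^p`, and its inverse Fourier transform is
`z ↦ φ(zᵀΣz)` where `φ(s) = ∫ e^{−ts} dμ(t)`. -/
theorem gaussian_mixture_fourier_inversion
    (p : ℕ) (hp : 0 < p)
    (m : ℝ) (hm : 0 < m)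
    (μ : Measure ℝ) [IsFiniteMeasure μ] (hμsupp : μ (Set.Iio m) = 0)
    (Sg : Matrix (Fin p) (Fin p) ℝ) (hSg : Sg.PosDef)
    (Q : (Fin p → ℝ) → ℝ)
    (hQ : ∀ ω : Fin p → ℝ, Q ω = ∫ t,
      (Real.sqrt Sg.det)⁻¹ * (4 * π * t) ^ (-(p : ℝ) / 2)
        * Real.exp (-(1 / (4 * t)) * (ω ⬝ᵥ (Sg⁻¹ *ᵥ ω))) ∂μ)
    (φ : ℝ → ℝ) (hφ : ∀ s : ℝ, φ s = ∫ t, Real.exp (-t * s) ∂μ) :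
    (∀ ω, 0 ≤ Q ω) ∧
    Integrable Q (volume : Measure (Fin p → ℝ)) ∧
    (∀ z : Fin p → ℝ,
      ∫ ω : Fin p → ℝ, Complex.exp (Complex.I * ((ω ⬝ᵥ z : ℝ) : ℂ)) * (Q ω : ℂ)
        = ((φ (z ⬝ᵥ (Sg *ᵥ z)) : ℝ) : ℂ)) := by
  classical
  set K : ℝ → (Fin p → ℝ) → ℝ := fun t ω => (Real.sqrt Sg.det)⁻¹ * (4 * π * t) ^ (-(p : ℝ) / 2)
        * Real.exp (-(1 / (4 * t)) * (ω ⬝ᵥ (Sg⁻¹ *ᵥ ω))) with hK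
  have hae : ∀ᵐ t ∂μ, 0 < t := by
    have : ∀ᵐ t ∂μ, t ∉ Set.Iio m := measure_eq_zero_iff_ae_notMem.1 hμsupp
    filter_upwards [this] with t ht
    exact hm.trans_le (not_lt.1 ht)
  have hKnn : ∀ t ω, 0 < t → 0 ≤ K t ω := by
    intro t ω ht
    simp only [hK]
    positivity
  have hmeas : Measurable (Function.uncurry K) := by
    have hq : Measurable fun x : ℝ × (Fin p → ℝ) => x.2 ⬝ᵥ (Sg⁻¹ *ᵥ x.2) := by
      apply Continuous.measurable
      fun_prop
    simp only [hK, Function.uncurry_def]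
    fun_prop
  have key := fun t ht z => gm_key Sg hSg t ht z
  have hKi : ∀ t, 0 < t → Integrable (K t) ∧ ∫ ω, K t ω = 1 := by
    intro t ht
    obtain ⟨h1, h2⟩ := key t ht 0
    simp only [dotProduct_zero, Complex.ofReal_zero, mul_zero, Complex.exp_zero, one_mul,
      zero_dotProduct, Real.exp_zero] at h1 h2
    refine ⟨?_, ?_⟩
    · exact h1.re
    · rw [integral_complex_ofReal] at h2
      exact Complex.ofReal_injective h2
  have hprod : Integrable (Function.uncurry K) (μ.prod volume) := by
    rw [integrable_prod_iff hmeas.aestronglyMeasurable]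
    refine ⟨?_, ?_⟩
    · filter_upwards [hae] with t ht using (hKi t ht).1
    · refine (integrable_const (1 : ℝ)).congr ?_
      filter_upwards [hae] with t ht
      rw [← (hKi t ht).2]
      refine integral_congr_ae (Filter.Eventually.of_forall fun ω => ?_)
      exact (Real.norm_of_nonneg (hKnn t ω ht)).symm
  have hQ' : Q = fun ω => ∫ t, K t ω ∂μ := funext hQ
  refine ⟨?_, ?_, ?_⟩
  · intro ω
    rw [hQ']
    exact integral_nonneg_of_ae (by filter_upwards [hae] with t ht using hKnn t ω ht)
  · rw [hQ']
    exact hprod.integral_prod_right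
  · intro z
    have hG : Integrable (Function.uncurry fun (t : ℝ) (ω : Fin p → ℝ) =>
        Complex.exp (Complex.I * ((ω ⬝ᵥ z : ℝ) : ℂ)) * (K t ω : ℂ)) (μ.prod volume) := by
      have hc : Measurable fun x : ℝ × (Fin p → ℝ) =>
          Complex.exp (Complex.I * ((x.2 ⬝ᵥ z : ℝ) : ℂ)) := by
        apply Continuous.measurable
        fun_prop
      refine Integrable.bdd_mul (c := 1) hprod.ofReal hc.aestronglyMeasurable ?_
      refine Filter.Eventually.of_forall fun x => ?_
      rw [mul_comm, Complex.norm_exp_ofReal_mul_I]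
    have e : ∀ ω : Fin p → ℝ, Complex.exp (Complex.I * ((ω ⬝ᵥ z : ℝ) : ℂ)) * (Q ω : ℂ)
        = ∫ t, Complex.exp (Complex.I * ((ω ⬝ᵥ z : ℝ) : ℂ)) * (K t ω : ℂ) ∂μ := by
      intro ω
      rw [integral_const_mul, integral_complex_ofReal, hQ']
    simp_rw [e]
    rw [← integral_integral_swap hG, hφ, ← integral_complex_ofReal]
    refine integral_congr_ae ?_
    filter_upwards [hae] with t ht
    exact (key t ht z).2
end
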